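/- Let G be a finite connected simple graph. Then there exists a vertex labeling l : V(G) → ℝ≥0 such that 2|D(V(G))| = 2 + Σ_{v ∈ V(G)} deg_G(v) (where D(V(G)) is the distance set of the pseudoultrametric space (V(G), d_l) generated by G(l)) if and only if G is a tree. -/

import Mathlib

open Classical in
/-- The distance `d_l` generated by a labeled graph `G(l)`:
`d_l x x = 0` and, for `x ≠ y`,
`d_l x y = inf over paths P joining x and y of (max_{v ∈ V(P)} l v)`. -/
noncomputable def labelDist {V : Type*} (G : SimpleGraph V) (l : V → NNReal)
    (x y : V) : NNReal :=
  if x = y then 0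
  else ⨅ p : {p : G.Walk x y // p.IsPath}, (p.1.support.map l).foldr max 0

/-- The distance set `D(X) = {d(x,y) : x,y ∈ X}`. -/
def distSet {X : Type*} (d : X → X → NNReal) : Set NNReal :=
  {r | ∃ x y, d x y = r}

theorem List.le_foldr_max_of_mem {α : Type*} [LinearOrder α] (b : α) {L : List α} {a : α}
    (h : a ∈ L) : a ≤ L.foldr max b := by
  induction L with
  | nil => simp at h
  | cons c L ih =>
    rcases List.mem_cons.1 h with rfl | h
    · exact le_max_left _ _
    · exact (ih h).trans (le_max_right _ _)

theorem List.foldr_max_eq_or_mem {α : Type*} [LinearOrder α] (b : α) (L : List α) :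
    L.foldr max b = b ∨ L.foldr max b ∈ L := by
  induction L with
  | nil => simp
  | cons c L ih =>
    rw [List.foldr_cons]
    rcases max_choice c (L.foldr max b) with h | h
    · simp [h]
    · rw [h]
      exact ih.imp_right (List.mem_cons_of_mem _)

section LabelDist

variable {V : Type*} {G : SimpleGraph V} {l : V → NNReal}

theorem SimpleGraph.Connected.exists_isPath_labelDist_eq [Finite V] (hc : G.Connected)
    (l : V → NNReal) {x y : V} (hxy : x ≠ y) :
    ∃ p : G.Walk x y, p.IsPath ∧ labelDist G l x y = (p.support.map l).foldr max 0 := by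
  let f : {p : G.Walk x y // p.IsPath} → NNReal := fun p => (p.1.support.map l).foldr max 0
  obtain ⟨q, hq⟩ := (hc.preconnected x y).exists_isPath
  have hfin : (Set.range f).Finite := by
    refine ((Set.finite_range l).insert 0).subset ?_
    rintro _ ⟨p, rfl⟩
    rcases List.foldr_max_eq_or_mem 0 (p.1.support.map l) with h | h
    · exact Or.inl h
    · obtain ⟨w, -, hw⟩ := List.mem_map.1 h
      exact Or.inr ⟨w, hw⟩
  obtain ⟨p, hp⟩ := Set.Nonempty.csInf_mem (⟨_, ⟨q, hq⟩, rfl⟩ : (Set.range f).Nonempty) hfin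
  exact ⟨p.1, p.2, by rw [labelDist, if_neg hxy]; exact hp.symm⟩

theorem labelDist_self (x : V) : labelDist G l x x = 0 := if_pos rfl

theorem labelDist_eq_of_adj_of_le [Finite V] (hc : G.Connected) {u v : V} (h : G.Adj u v)
    (hl : l u ≤ l v) : labelDist G l u v = l v := by
  apply le_antisymm
  · rw [labelDist, if_neg h.ne]
    refine (ciInf_le (OrderBot.bddBelow _) ⟨h.toWalk, by simp [h.ne]⟩).trans ?_
    simp [hl]
  · obtain ⟨p, -, hp⟩ := hc.exists_isPath_labelDist_eq l h.ne
    rw [hp]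
    exact List.le_foldr_max_of_mem 0 (List.mem_map_of_mem p.end_mem_support)

theorem distSet_labelDist_subset [Finite V] (hc : G.Connected) {r : V} (hr : ∀ v, l r ≤ l v) :
    distSet (labelDist G l) ⊆ insert 0 (l '' {r}ᶜ) := by
  rintro _ ⟨x, y, rfl⟩
  by_cases hxy : x = y
  · exact Or.inl (hxy ▸ labelDist_self x)
  obtain ⟨p, -, hp⟩ := hc.exists_isPath_labelDist_eq l hxy
  rw [hp]
  rcases List.foldr_max_eq_or_mem 0 (p.support.map l) with h | h
  · exact Or.inl h
  obtain ⟨w, -, hw⟩ := List.mem_map.1 h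
  right
  by_cases hwr : w = r
  · subst hwr
    have key : ∀ z ∈ p.support, z ≠ w → (p.support.map l).foldr max 0 ∈ l '' {w}ᶜ :=
      fun z hz hzw => ⟨z, hzw, le_antisymm
        (List.le_foldr_max_of_mem 0 (List.mem_map_of_mem hz)) (hw ▸ hr z)⟩
    by_cases hxw : x = w
    · exact key y p.end_mem_support fun hyw => hxy (hxw.trans hyw.symm)
    · exact key x p.start_mem_support hxw
  · exact ⟨w, hwr, hw⟩

theorem ncard_distSet_labelDist_le [Finite V] (hc : G.Connected) (l : V → NNReal) :
    (distSet (labelDist G l)).ncard ≤ Nat.card V := by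
  have := hc.nonempty
  obtain ⟨r, hr⟩ := Finite.exists_min l
  calc (distSet (labelDist G l)).ncard
      ≤ (insert 0 (l '' {r}ᶜ)).ncard := Set.ncard_le_ncard (distSet_labelDist_subset hc hr)
    _ ≤ (l '' {r}ᶜ).ncard + 1 := Set.ncard_insert_le _ _
    _ ≤ ({r}ᶜ : Set V).ncard + 1 := by gcongr; exact Set.ncard_image_le
    _ = Nat.card V := by
      rw [← Set.ncard_singleton r, add_comm, Set.ncard_add_ncard_compl]

theorem SimpleGraph.Connected.exists_adj_dist_lt (hc : G.Connected) {v r : V} (h : v ≠ r) :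
    ∃ u, G.Adj u v ∧ G.dist u r < G.dist v r := by
  obtain ⟨p, hp⟩ := hc.exists_walk_length_eq_dist v r
  cases p with
  | nil => exact absurd rfl h
  | cons hadj q =>
    refine ⟨_, hadj.symm, ?_⟩
    rw [← hp, SimpleGraph.Walk.length_cons]
    exact Nat.lt_succ_of_le (SimpleGraph.dist_le q)

theorem SimpleGraph.Connected.exists_ncard_distSet_labelDist_eq [Finite V] (hc : G.Connected) :
    ∃ l : V → NNReal, (distSet (labelDist G l)).ncard = Nat.card V := by
  obtain ⟨r⟩ := hc.nonempty
  let n := Nat.card V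
  let e : V ≃ Fin n := Finite.equivFin V
  let l : V → NNReal := fun v => ((e v + G.dist v r * n + 1 : ℕ) : NNReal)
  have hinj : Function.Injective l := by
    intro u v h
    have h' : (e u : ℕ) + G.dist u r * n = e v + G.dist v r * n :=
      Nat.succ_injective (Nat.cast_injective h)
    have := congrArg (· % n) h'
    simp only [Nat.add_mul_mod_self_right, Nat.mod_eq_of_lt (e _).isLt] at this
    exact e.injective (Fin.ext this)
  have hsub : insert 0 (l '' {r}ᶜ) ⊆ distSet (labelDist G l) := by
    rintro _ (rfl | ⟨v, hv, rfl⟩)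
    · exact ⟨r, r, labelDist_self r⟩
    · obtain ⟨u, hadj, hlt⟩ := hc.exists_adj_dist_lt hv
      refine ⟨u, v, labelDist_eq_of_adj_of_le hc hadj (Nat.cast_le.2 ?_)⟩
      have hu := (e u).isLt
      have := Nat.mul_le_mul_right n (Nat.succ_le_of_lt hlt)
      rw [Nat.succ_mul] at this
      lia
  have hfin : (distSet (labelDist G l)).Finite :=
    (Set.finite_range fun q : V × V => labelDist G l q.1 q.2).subset
      fun _ ⟨x, y, h⟩ => ⟨(x, y), h⟩
  refine ⟨l, (ncard_distSet_labelDist_le hc l).antisymm ?_⟩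
  have h0 : (0 : NNReal) ∉ l '' {r}ᶜ := by
    rintro ⟨v, -, hv⟩
    exact Nat.succ_ne_zero _ (Nat.cast_eq_zero.1 hv)
  have hcard := Set.ncard_le_ncard hsub hfin
  rwa [Set.ncard_insert_of_notMem h0, Set.ncard_image_of_injective _ hinj,
    ← Set.ncard_singleton r, add_comm, Set.ncard_add_ncard_compl] at hcard

end LabelDist

/-- A finite connected simple graph `G` admits a labeling `l`
with `2|D(V(G))| = 2 + Σ_v deg_G(v)` iff `G` is a tree. -/
theorem exists_labeling_two_mul_distSet_card_iff_isTree {V : Type*} [Fintype V]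
    (G : SimpleGraph V) [DecidableRel G.Adj] (hc : G.Connected) :
    (∃ l : V → NNReal,
        2 * (distSet (labelDist G l)).ncard = 2 + ∑ v : V, G.degree v) ↔
      G.IsTree := by
  classical
  rw [SimpleGraph.sum_degrees_eq_twice_card_edges, SimpleGraph.isTree_iff_connected_and_card,
    SimpleGraph.edgeFinset_card, ← Nat.card_eq_fintype_card]
  constructor
  · rintro ⟨l, hl⟩
    have := ncard_distSet_labelDist_le hc l
    have := hc.card_vert_le_card_edgeSet_add_one
    exact ⟨hc, by lia⟩
  · rintro ⟨-, h⟩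
    obtain ⟨l, hl⟩ := hc.exists_ncard_distSet_labelDist_eq
    exact ⟨l, by lia⟩
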